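/- arXiv:2306.05413 — 3 statements merged into one kernel-verified Lean document; each statement's English description precedes it below -/
import Mathlib

section
/- Let n ≥ 2 and let α : ℝ^{n-1} × ℝ → ℝ be continuously differentiable. For every d > 0, setting Q = [−1,1]^{n−1} and S = Q × [−1, 1+d], one has ∫_{Q × [d−1, d+1]} α² ≤ ∫_{Q × [−1,1]} α² + 4 (∫_S α²)^{1/2} (∫_S (∂ₜα)²)^{1/2}, where ∂ₜα denotes the partial derivative of α in the last coordinate. -/
open MeasureTheory Set

/-- The unit cube `[-1,1]^m` in `ℝ^m`. -/
def unitCube (m : ℕ) : Set (Fin m → ℝ) := Set.Icc (fun _ => (-1 : ℝ)) (fun _ => (1 : ℝ))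

/-- One-dimensional slice estimate. -/
lemma slice_estimate (φ ψ : ℝ → ℝ) (h : ∀ t, HasDerivAt φ (ψ t) t) (hψ : Continuous ψ)
    (d : ℝ) (hd : 0 < d) :
    (∫ t in (d - 1)..(d + 1), φ t ^ 2)
      ≤ (∫ t in (-1 : ℝ)..1, φ t ^ 2) + 4 * ∫ t in (-1 : ℝ)..(1 + d), |φ t| * |ψ t| := by
  have hφ : Continuous φ := continuous_iff_continuousAt.2 fun t => (h t).continuousAt
  have e1 : (∫ t in (d - 1)..(d + 1), φ t ^ 2) = ∫ s in (-1 : ℝ)..1, φ (s + d) ^ 2 := by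
    rw [intervalIntegral.integral_comp_add_right (fun t => φ t ^ 2) d]
    congr 1 <;> ring
  set K := ∫ t in (-1 : ℝ)..(1 + d), |φ t| * |ψ t| with hK
  have e2 : ∀ s ∈ Icc (-1 : ℝ) 1, φ (s + d) ^ 2 ≤ φ s ^ 2 + 2 * K := by
    intro s hs
    have ftc : ∫ t in s..(s + d), 2 * (φ t * ψ t) = φ (s + d) ^ 2 - φ s ^ 2 := by
      apply intervalIntegral.integral_eq_sub_of_hasDerivAt (f := fun t => φ t ^ 2)
      · intro t _
        exact ((h t).fun_pow 2).congr_deriv (by push_cast; ring)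
      · exact (by fun_prop : Continuous fun t => 2 * (φ t * ψ t)).intervalIntegrable _ _
    have h1 : ∫ t in s..(s + d), 2 * (φ t * ψ t) ≤ ∫ t in s..(s + d), 2 * (|φ t| * |ψ t|) := by
      apply intervalIntegral.integral_mono_on (by linarith)
      · exact (by fun_prop : Continuous fun t => 2 * (φ t * ψ t)).intervalIntegrable _ _
      · exact (by fun_prop : Continuous fun t => 2 * (|φ t| * |ψ t|)).intervalIntegrable _ _
      · intro t _
        rw [← abs_mul]
        linarith [le_abs_self (φ t * ψ t)]
    have h2 : ∫ t in s..(s + d), |φ t| * |ψ t| ≤ K := by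
      apply intervalIntegral.integral_mono_interval hs.1 (by linarith) (by linarith [hs.2])
      · exact Filter.Eventually.of_forall fun t => by positivity
      · exact (by fun_prop : Continuous fun t => |φ t| * |ψ t|).intervalIntegrable _ _
    rw [intervalIntegral.integral_const_mul 2 (fun t => |φ t| * |ψ t|)] at h1
    linarith
  have h3 : (∫ s in (-1 : ℝ)..1, φ (s + d) ^ 2) ≤ ∫ s in (-1 : ℝ)..1, (φ s ^ 2 + 2 * K) := by
    apply intervalIntegral.integral_mono_on (by norm_num) _ _ e2
    · exact (by fun_prop : Continuous fun s => φ (s + d) ^ 2).intervalIntegrable _ _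
    · exact (by fun_prop : Continuous fun s => φ s ^ 2 + 2 * K).intervalIntegrable _ _
  rw [intervalIntegral.integral_add
    ((by fun_prop : Continuous fun s => φ s ^ 2).intervalIntegrable _ _)
    (by simp), intervalIntegral.integral_const] at h3
  rw [e1]
  simp only [smul_eq_mul] at h3
  linarith

lemma isCompact_unitCube (m : ℕ) : IsCompact (unitCube m) := isCompact_Icc

lemma prod_slices (m : ℕ) (F : (Fin m → ℝ) × ℝ → ℝ) (hF : Continuous F) (a b : ℝ) (hab : a ≤ b) :
    (∫ p in unitCube m ×ˢ Icc a b, F p) = ∫ x in unitCube m, ∫ t in a..b, F (x, t) := by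
  rw [Measure.volume_eq_prod, setIntegral_prod]
  · simp only [intervalIntegral.integral_of_le hab, integral_Icc_eq_integral_Ioc]
  · exact hF.continuousOn.integrableOn_compact ((isCompact_unitCube m).prod isCompact_Icc)

lemma slices_integrable (m : ℕ) (F : (Fin m → ℝ) × ℝ → ℝ) (hF : Continuous F) (a b : ℝ) :
    IntegrableOn (fun x => ∫ t in a..b, F (x, t)) (unitCube m) := by
  apply ContinuousOn.integrableOn_compact (isCompact_unitCube m)
  apply Continuous.continuousOn
  exact intervalIntegral.continuous_parametric_intervalIntegral_of_continuous'
    (f := fun x t => F (x, t)) (by simpa [Function.uncurry_def] using hF) a b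

lemma cauchy_schwarz_set (m : ℕ) (F G : (Fin m → ℝ) × ℝ → ℝ) (hF : Continuous F)
    (hG : Continuous G) (s : Set ((Fin m → ℝ) × ℝ)) (hs : IsCompact s) :
    (∫ p in s, |F p| * |G p|) ≤ Real.sqrt (∫ p in s, F p ^ 2) * Real.sqrt (∫ p in s, G p ^ 2) := by
  have hm : ∀ H : (Fin m → ℝ) × ℝ → ℝ, Continuous H →
      MemLp H (ENNReal.ofReal 2) (volume.restrict s) := by
    intro H hH
    rw [show ENNReal.ofReal 2 = 2 by simp]
    rw [memLp_two_iff_integrable_sq hH.aestronglyMeasurable]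
    exact (hH.pow 2).continuousOn.integrableOn_compact hs
  have := integral_mul_norm_le_Lp_mul_Lq (μ := volume.restrict s) (p := 2) (q := 2)
    Real.HolderConjugate.two_two (hm F hF) (hm G hG)
  simpa [Real.sqrt_eq_rpow] using this

/-- The Euclidean shifted-cube estimate underlying the Poincaré-type Lemma 2.5:
for a `C¹` function `α : ℝ^{n-1} × ℝ → ℝ` and `d > 0`, with `Q = [−1,1]^{n−1}` and
`S = Q × [−1, 1+d]`,
`∫_{Q × [d−1, d+1]} α² ≤ ∫_{Q × [−1,1]} α² + 4 (∫_S α²)^{1/2} (∫_S (∂ₜα)²)^{1/2}`. -/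
theorem stmt_1 (n : ℕ) (hn : 2 ≤ n) (α : (Fin (n - 1) → ℝ) × ℝ → ℝ)
    (hα : ContDiff ℝ 1 α) (d : ℝ) (hd : 0 < d) :
    (∫ p in unitCube (n - 1) ×ˢ Icc (d - 1) (d + 1), (α p) ^ 2)
      ≤ (∫ p in unitCube (n - 1) ×ˢ Icc (-1 : ℝ) 1, (α p) ^ 2)
        + 4 * Real.sqrt (∫ p in unitCube (n - 1) ×ˢ Icc (-1 : ℝ) (1 + d), (α p) ^ 2)
            * Real.sqrt (∫ p in unitCube (n - 1) ×ˢ Icc (-1 : ℝ) (1 + d),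
                (deriv (fun t => α (p.1, t)) p.2) ^ 2) := by
  set g : (Fin (n - 1) → ℝ) × ℝ → ℝ := fun p => deriv (fun t => α (p.1, t)) p.2 with hg
  have hder : ∀ x t, HasDerivAt (fun t => α (x, t)) (fderiv ℝ α (x, t) (0, 1)) t := by
    intro x t
    have h1 : HasFDerivAt α (fderiv ℝ α (x, t)) (x, t) :=
      (hα.differentiable (by simp) (x, t)).hasFDerivAt
    exact h1.comp_hasDerivAt t ((hasDerivAt_const t x).prodMk (hasDerivAt_id t))
  have hgeq : g = fun p => fderiv ℝ α p (0, 1) := by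
    funext p
    exact (hder p.1 p.2).deriv
  have hgc : Continuous g := by
    rw [hgeq]
    exact (hα.continuous_fderiv (by simp)).clm_apply continuous_const
  have hac : Continuous α := hα.continuous
  have ha2 : Continuous fun p => α p ^ 2 := hac.pow 2
  have hag : Continuous fun p => |α p| * |g p| := by fun_prop
  have hcs := cauchy_schwarz_set (n - 1) α g hac hgc (unitCube (n - 1) ×ˢ Icc (-1 : ℝ) (1 + d))
    ((isCompact_unitCube _).prod isCompact_Icc)
  have key : (∫ p in unitCube (n - 1) ×ˢ Icc (d - 1) (d + 1), (α p) ^ 2)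
      ≤ (∫ p in unitCube (n - 1) ×ˢ Icc (-1 : ℝ) 1, (α p) ^ 2)
        + 4 * ∫ p in unitCube (n - 1) ×ˢ Icc (-1 : ℝ) (1 + d), |α p| * |g p| := by
    rw [prod_slices _ _ ha2 _ _ (by linarith), prod_slices _ _ ha2 _ _ (by linarith),
      prod_slices _ _ hag _ _ (by linarith), ← integral_const_mul, ← integral_add
      (slices_integrable _ _ ha2 _ _) ((slices_integrable _ _ hag _ _).const_mul 4)]
    apply integral_mono (slices_integrable _ _ ha2 _ _)
      ((slices_integrable _ _ ha2 _ _).add ((slices_integrable _ _ hag _ _).const_mul 4))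
    intro x
    apply slice_estimate (fun t => α (x, t)) (fun t => g (x, t)) _ (by fun_prop) d hd
    intro t
    rw [hgeq]
    exact hder x t
  rw [mul_assoc]
  linarith
end

section
/- Let n ≥ 2, L > 0, 0 < δ ≤ L, and let α : ℝ^{n-1} × ℝ → ℝ be continuously differentiable. Then ∫_{Q × [0,L]} α² ≤ (2L/δ) ∫_{Q × [0,δ]} α² + 2L² ∫_{Q × [0,L]} (∂ₜα)², where Q = [−1,1]^{n−1} is the unit cube and ∂ₜα denotes the partial derivative of α in the last coordinate. -/
open MeasureTheory Set

lemma cs_aux (g : ℝ → ℝ) (hg : Continuous g) (a b : ℝ) (hab : a ≤ b) :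
    (∫ x in a..b, g x) ^ 2 ≤ (b - a) * ∫ x in a..b, (g x) ^ 2 := by
  rcases hab.eq_or_lt with rfl | h
  · simp
  set G := ∫ x in a..b, g x with hG
  have hpos : 0 < b - a := sub_pos.2 h
  have h0 : 0 ≤ ∫ x in a..b, ((b - a) * g x - G) ^ 2 :=
    intervalIntegral.integral_nonneg hab (fun x _ => sq_nonneg _)
  have h1 : (∫ x in a..b, ((b - a) * g x - G) ^ 2)
      = (b - a) ^ 2 * (∫ x in a..b, (g x) ^ 2) - 2 * (b - a) * G * G + (b - a) * G ^ 2 := by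
    have e : (fun x => ((b - a) * g x - G) ^ 2)
        = fun x => ((b - a) ^ 2 * (g x) ^ 2 - 2 * (b - a) * G * g x) + G ^ 2 := by
      funext x; ring
    rw [e, intervalIntegral.integral_add, intervalIntegral.integral_sub,
      intervalIntegral.integral_const_mul, intervalIntegral.integral_const_mul,
      intervalIntegral.integral_const, smul_eq_mul, ← hG]
    all_goals exact Continuous.intervalIntegrable (by fun_prop) _ _
  rw [h1] at h0
  have h2 : 0 ≤ (b - a) * ((b - a) * (∫ x in a..b, (g x) ^ 2) - G ^ 2) := by linarith
  have := nonneg_of_mul_nonneg_right h2 hpos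
  linarith

lemma pt_aux (f : ℝ → ℝ) (hf : ContDiff ℝ 1 f) (L s t : ℝ) (hs : s ∈ Icc 0 L) (ht : t ∈ Icc 0 L) :
    (f t) ^ 2 ≤ 2 * (f s) ^ 2 + 2 * L * ∫ x in (0:ℝ)..L, (deriv f x) ^ 2 := by
  have hc : Continuous (deriv f) := hf.continuous_deriv le_rfl
  have hd : Differentiable ℝ f := hf.differentiable one_ne_zero
  have key : ∀ u v : ℝ, u ∈ Icc 0 L → v ∈ Icc 0 L → u ≤ v →
      (f v - f u) ^ 2 ≤ L * ∫ x in (0:ℝ)..L, (deriv f x) ^ 2 := by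
    intro u v hu hv huv
    rw [← intervalIntegral.integral_deriv_eq_sub (fun x _ => hd x) (hc.intervalIntegrable _ _)]
    refine (cs_aux _ hc u v huv).trans ?_
    have h1 : (∫ x in u..v, (deriv f x) ^ 2) ≤ ∫ x in (0:ℝ)..L, (deriv f x) ^ 2 :=
      intervalIntegral.integral_mono_interval hu.1 huv hv.2
        (Filter.Eventually.of_forall fun x => sq_nonneg _)
        ((hc.pow 2).intervalIntegrable _ _)
    have h2 : 0 ≤ ∫ x in u..v, (deriv f x) ^ 2 :=
      intervalIntegral.integral_nonneg huv (fun x _ => sq_nonneg _)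
    exact mul_le_mul (by linarith [hu.1, hv.2]) h1 h2 (hu.1.trans hu.2)
  have : (f t - f s) ^ 2 ≤ L * ∫ x in (0:ℝ)..L, (deriv f x) ^ 2 := by
    rcases le_total s t with h | h
    · exact key s t hs ht h
    · have := key t s ht hs h
      nlinarith
  nlinarith [sq_nonneg (f t - 2 * f s)]

lemma one_aux (f : ℝ → ℝ) (hf : ContDiff ℝ 1 f) (L δ : ℝ) (hL : 0 < L) (hδ : 0 < δ) (hδL : δ ≤ L) :
    (∫ t in Icc (0:ℝ) L, (f t) ^ 2) ≤ (2 * L / δ) * (∫ t in Icc (0:ℝ) δ, (f t) ^ 2)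
      + 2 * L ^ 2 * ∫ t in Icc (0:ℝ) L, (deriv f t) ^ 2 := by
  simp only [integral_Icc_eq_integral_Ioc]
  rw [← intervalIntegral.integral_of_le hL.le, ← intervalIntegral.integral_of_le hδ.le,
    ← intervalIntegral.integral_of_le hL.le]
  have hc : Continuous f := hf.continuous
  set D := ∫ x in (0:ℝ)..L, (deriv f x) ^ 2 with hD
  set A := ∫ x in (0:ℝ)..δ, (f x) ^ 2 with hA
  have h1 : ∀ t ∈ Icc 0 L, (f t) ^ 2 ≤ 2 / δ * A + 2 * L * D := by
    intro t ht
    have : (∫ s in (0:ℝ)..δ, (f t) ^ 2) ≤ ∫ s in (0:ℝ)..δ, (2 * (f s) ^ 2 + 2 * L * D) :=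
      intervalIntegral.integral_mono_on hδ.le (Continuous.intervalIntegrable (by fun_prop) _ _)
        (Continuous.intervalIntegrable (by fun_prop) _ _)
        (fun s hs => pt_aux f hf L s t ⟨hs.1, hs.2.trans hδL⟩ ht)
    rw [intervalIntegral.integral_add (Continuous.intervalIntegrable (by fun_prop) _ _)
      (Continuous.intervalIntegrable (by fun_prop) _ _), intervalIntegral.integral_const_mul,
      intervalIntegral.integral_const, intervalIntegral.integral_const, ← hA, smul_eq_mul,
      smul_eq_mul, sub_zero] at this
    have e : 2 / δ * A + 2 * L * D = (2 * A + δ * (2 * L * D)) / δ := by field_simp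
    rw [e, le_div_iff₀ hδ]
    linarith
  have h2 : (∫ t in (0:ℝ)..L, (f t) ^ 2) ≤ ∫ t in (0:ℝ)..L, (2 / δ * A + 2 * L * D) :=
    intervalIntegral.integral_mono_on hL.le (Continuous.intervalIntegrable (by fun_prop) _ _)
        (Continuous.intervalIntegrable (by fun_prop) _ _) h1
  rw [intervalIntegral.integral_const, smul_eq_mul, sub_zero] at h2
  refine h2.trans (le_of_eq ?_)
  ring

/-- Euclidean box model of the Poincaré-type inequality of Lemma 2.5:
for a `C¹` function `α : ℝ^{n-1} × ℝ → ℝ`, `L > 0` and `0 < δ ≤ L`,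
`∫_{Q × [0,L]} α² ≤ (2L/δ) ∫_{Q × [0,δ]} α² + 2L² ∫_{Q × [0,L]} (∂ₜα)²`,
where `Q = [−1,1]^{n−1}`. -/
theorem stmt_2 (n : ℕ) (hn : 2 ≤ n) (L δ : ℝ) (hL : 0 < L) (hδ : 0 < δ) (hδL : δ ≤ L)
    (α : (Fin (n - 1) → ℝ) × ℝ → ℝ) (hα : ContDiff ℝ 1 α) :
    (∫ p in unitCube (n - 1) ×ˢ Icc (0 : ℝ) L, (α p) ^ 2)
      ≤ (2 * L / δ) * (∫ p in unitCube (n - 1) ×ˢ Icc (0 : ℝ) δ, (α p) ^ 2)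
        + 2 * L ^ 2 * (∫ p in unitCube (n - 1) ×ˢ Icc (0 : ℝ) L,
            (deriv (fun t => α (p.1, t)) p.2) ^ 2) := by
  have hc : Continuous α := hα.continuous
  have hslice : ∀ x, ContDiff ℝ 1 (fun t => α (x, t)) := fun x =>
    hα.comp (contDiff_const.prodMk contDiff_id)
  have hdc : Continuous (fun p : (Fin (n - 1) → ℝ) × ℝ => deriv (fun t => α (p.1, t)) p.2) := by
    have e : (fun p : (Fin (n - 1) → ℝ) × ℝ => deriv (fun t => α (p.1, t)) p.2)
        = fun p => fderiv ℝ α p (0, 1) := by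
      funext p
      have h1 : HasDerivAt (fun t : ℝ => (p.1, t)) ((0 : Fin (n - 1) → ℝ), (1:ℝ)) p.2 :=
        (hasDerivAt_const p.2 p.1).prodMk (hasDerivAt_id p.2)
      have h2 : HasFDerivAt α (fderiv ℝ α p) (p.1, p.2) :=
        (hα.differentiable one_ne_zero p).hasFDerivAt
      exact (h2.comp_hasDerivAt p.2 h1).deriv
    rw [e]
    exact (hα.continuous_fderiv one_ne_zero).clm_apply continuous_const
  have hQ : IsCompact (unitCube (n - 1)) := isCompact_Icc
  have hint : ∀ (M : ℝ) (g : (Fin (n - 1) → ℝ) × ℝ → ℝ), Continuous g →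
      IntegrableOn g (unitCube (n - 1) ×ˢ Icc (0:ℝ) M)
        ((volume : Measure (Fin (n - 1) → ℝ)).prod (volume : Measure ℝ)) := fun M g hg =>
    hg.continuousOn.integrableOn_compact (hQ.prod isCompact_Icc)
  have hint' : ∀ (M : ℝ) (g : (Fin (n - 1) → ℝ) × ℝ → ℝ), Continuous g →
      IntegrableOn (fun x => ∫ t in Icc (0:ℝ) M, g (x, t)) (unitCube (n - 1)) := by
    intro M g hg
    have := hint M g hg
    rw [IntegrableOn, ← Measure.prod_restrict] at this
    exact this.integral_prod_left
  have hc2 : Continuous (fun p => (α p) ^ 2) := hc.pow 2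
  have hdc2 : Continuous (fun p : (Fin (n - 1) → ℝ) × ℝ =>
      (deriv (fun t => α (p.1, t)) p.2) ^ 2) := hdc.pow 2
  rw [Measure.volume_eq_prod, setIntegral_prod _ (hint L _ hc2),
    setIntegral_prod _ (hint δ _ hc2), setIntegral_prod _ (hint L _ hdc2),
    ← integral_const_mul, ← integral_const_mul, ← integral_add]
  · refine integral_mono (hint' L _ hc2) ?_ ?_
    · exact ((hint' δ _ hc2).const_mul _).add ((hint' L _ hdc2).const_mul _)
    · intro x
      exact one_aux (fun t => α (x, t)) (hslice x) L δ hL hδ hδL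
  · exact (hint' δ _ hc2).const_mul _
  · exact (hint' L _ hdc2).const_mul _
end

section
/- Let c > 0, 0 < ε < c, and ε' > 0. Then there exists ε₀'' > 0 such that for every ε'' with 0 < ε'' < ε₀'', there exist γ with ε < γ < c and a smooth (C^∞) function χ : ℝ → ℝ such that: (i) χ(−γ) = −c and χ(γ) = c; (ii) 1−ε'' ≤ χ'(r) ≤ 1+ε' for all r with |r| ≤ ε; (iii) χ'(r) = 1−ε'' for all r with ε ≤ |r| ≤ γ; and (iv) |χ(r)| ≥ |r| for all r ∈ [−γ,γ]. -/
open Set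

lemma exists_Phi (ε : ℝ) (hε : 0 < ε) : ∃ Φ : ℝ → ℝ, ContDiff ℝ (⊤ : ℕ∞) Φ ∧
    (∀ r, Φ (-r) = -Φ r) ∧ (∀ r, 0 ≤ deriv Φ r ∧ deriv Φ r ≤ 1) ∧
    (∀ r, ε ≤ |r| → deriv Φ r = 0) ∧ (∀ r, ε ≤ r → Φ r = Φ ε) ∧
    (∀ r, 0 ≤ r → r ≤ ε / 2 → Φ r = r) ∧ Monotone Φ ∧ Φ ε ≤ ε := by
  let φ : ContDiffBump (0 : ℝ) := ⟨ε / 2, ε, by linarith, by linarith⟩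
  have hsm : ContDiff ℝ (⊤ : ℕ∞) (φ : ℝ → ℝ) := φ.contDiff
  have hcont : Continuous (φ : ℝ → ℝ) := hsm.continuous
  have hint : ∀ a b, IntervalIntegrable (φ : ℝ → ℝ) MeasureTheory.volume a b :=
    fun a b => hcont.intervalIntegrable a b
  let Φ : ℝ → ℝ := fun r => ∫ x in (0 : ℝ)..r, φ x
  have hd : ∀ r, HasDerivAt Φ (φ r) r := fun r =>
    intervalIntegral.integral_hasDerivAt_right (hint 0 r)
      (hcont.stronglyMeasurableAtFilter _ _) hcont.continuousAt
  have hderiv : deriv Φ = φ := funext fun r => (hd r).deriv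
  have hz : ∀ r, ε ≤ |r| → φ r = 0 := fun r hr =>
    φ.zero_of_le_dist (by simpa [Real.dist_eq] using hr)
  have hmono : Monotone Φ := monotone_of_deriv_nonneg (fun r => (hd r).differentiableAt)
    (fun r => by rw [hderiv]; exact φ.nonneg)
  refine ⟨Φ, ?_, ?_, ?_, ?_, ?_, ?_, hmono, ?_⟩
  · rw [contDiff_infty_iff_deriv]
    exact ⟨fun r => (hd r).differentiableAt, by rw [hderiv]; exact hsm⟩
  · intro r
    have h := intervalIntegral.integral_comp_neg (a := 0) (b := r) (fun x => φ x)
    simp only [φ.neg, neg_zero] at h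
    show (∫ x in (0 : ℝ)..(-r), φ x) = -∫ x in (0 : ℝ)..r, φ x
    rw [h, intervalIntegral.integral_symm]
  · intro r; rw [hderiv]; exact ⟨φ.nonneg, φ.le_one⟩
  · intro r hr; rw [hderiv]; exact hz r hr
  · intro r hr
    have h1 : (∫ x in ε..r, φ x) = ∫ x in ε..r, (0 : ℝ) := by
      apply intervalIntegral.integral_congr
      intro x hx
      rw [uIcc_of_le hr] at hx
      exact hz x (hx.1.trans (le_abs_self x))
    have h2 := intervalIntegral.integral_add_adjacent_intervals (hint 0 ε) (hint ε r)
    rw [h1] at h2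
    simp only [intervalIntegral.integral_zero, add_zero] at h2
    exact h2.symm
  · intro r h0 hr
    have h1 : (∫ x in (0 : ℝ)..r, φ x) = ∫ x in (0 : ℝ)..r, (1 : ℝ) := by
      apply intervalIntegral.integral_congr
      intro x hx
      rw [uIcc_of_le h0] at hx
      apply φ.one_of_mem_closedBall
      rw [Metric.mem_closedBall, Real.dist_eq, sub_zero, abs_of_nonneg hx.1]
      exact hx.2.trans hr
    show (∫ x in (0 : ℝ)..r, φ x) = r
    rw [h1]; simp
  · have h1 : (∫ x in (0 : ℝ)..ε, φ x) ≤ ∫ x in (0 : ℝ)..ε, (1 : ℝ) :=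
      intervalIntegral.integral_mono_on hε.le (hint 0 ε) (by simp)
        (fun x _ => φ.le_one)
    show (∫ x in (0 : ℝ)..ε, φ x) ≤ ε
    simpa using h1

/-- Construction of the modified reparametrization function `χ` of Section 4
(doubly punctured sphere): for `c > 0`, `0 < ε < c` and `ε' > 0`, there is
`ε₀'' > 0` such that for any `0 < ε'' < ε₀''` there exist `γ ∈ (ε, c)` and a
smooth `χ : ℝ → ℝ` with `χ(±γ) = ±c`, `1−ε'' ≤ χ' ≤ 1+ε'` on `|r| ≤ ε`,
`χ' = 1−ε''` for `ε ≤ |r| ≤ γ`, and `|χ(r)| ≥ |r|` on `[−γ,γ]`. -/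
theorem stmt_5 (c ε ε' : ℝ) (hc : 0 < c) (hε : 0 < ε) (hεc : ε < c) (hε' : 0 < ε') :
    ∃ ε₀'' > (0 : ℝ), ∀ ε'' : ℝ, 0 < ε'' → ε'' < ε₀'' →
      ∃ γ : ℝ, ε < γ ∧ γ < c ∧
        ∃ χ : ℝ → ℝ, ContDiff ℝ (⊤ : ℕ∞) χ ∧
          χ (-γ) = -c ∧ χ γ = c ∧
          (∀ r : ℝ, |r| ≤ ε → 1 - ε'' ≤ deriv χ r ∧ deriv χ r ≤ 1 + ε') ∧
          (∀ r : ℝ, ε ≤ |r| → |r| ≤ γ → deriv χ r = 1 - ε'') ∧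
          (∀ r ∈ Icc (-γ) γ, |r| ≤ |χ r|) := by
  obtain ⟨Φ, hsm, hodd, hd01, hd0, hconst, hid, hmono, hle⟩ := exists_Phi ε hε
  refine ⟨min (1 / 2) (min ((c - ε) / (4 * c)) (ε * ε' / (4 * c))), ?_, ?_⟩
  · have : 0 < c - ε := by linarith
    refine lt_min (by norm_num) (lt_min (by positivity) (by positivity))
  intro δ hδ hlt
  obtain ⟨h1, hlt⟩ := lt_min_iff.1 hlt
  obtain ⟨h2, h3⟩ := lt_min_iff.1 hlt
  rw [lt_div_iff₀ (by positivity)] at h2 h3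
  obtain ⟨a, ha⟩ : ∃ a, a = 4 * c * δ / ε := ⟨_, rfl⟩
  have ha0 : 0 < a := by rw [ha]; positivity
  have haε : a * ε = 4 * c * δ := by rw [ha]; field_simp
  have haε' : a ≤ ε' := by
    rw [ha, div_le_iff₀ hε]; linarith
  have haδ : δ ≤ a := by
    rw [ha, le_div_iff₀ hε]; nlinarith
  have hhalf : Φ (ε / 2) = ε / 2 := hid _ (by linarith) le_rfl
  have hI : ε / 2 ≤ Φ ε := by rw [← hhalf]; exact hmono (by linarith)
  have hI1 : 2 * c * δ ≤ a * Φ ε := by nlinarith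
  have hI2 : a * Φ ε ≤ 4 * c * δ := by nlinarith
  have hp : 0 < 1 - δ := by linarith
  have hcδ : 0 < c * δ := by positivity
  obtain ⟨γ, hγ⟩ : ∃ γ, γ = (c - a * Φ ε) / (1 - δ) := ⟨_, rfl⟩
  have hγm : (1 - δ) * γ = c - a * Φ ε := by rw [hγ]; field_simp
  have hεγ : ε < γ := by
    rw [hγ, lt_div_iff₀ hp]; nlinarith
  have hγc : γ < c := by
    rw [hγ, div_lt_iff₀ hp]; nlinarith
  have hχγ : (1 - δ) * γ + a * Φ γ = c := by
    rw [hconst γ hεγ.le]; linarith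
  have hder : ∀ r, deriv (fun r => (1 - δ) * r + a * Φ r) r = (1 - δ) + a * deriv Φ r := by
    intro r
    have hΦ : HasDerivAt Φ (deriv Φ r) r :=
      ((hsm.differentiable (by simp)) r).hasDerivAt
    have := ((hasDerivAt_id r).const_mul (1 - δ)).add (hΦ.const_mul a)
    rw [mul_one] at this
    exact this.deriv
  have hpos : ∀ r, 0 ≤ r → r ≤ γ → r ≤ (1 - δ) * r + a * Φ r := by
    intro r h0 hr
    rcases le_total r (ε / 2) with h | h
    · rw [hid r h0 h]; nlinarith
    · have := hmono h
      rw [hhalf] at this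
      nlinarith
  refine ⟨γ, hεγ, hγc, fun r => (1 - δ) * r + a * Φ r, ?_, ?_, hχγ, ?_, ?_, ?_⟩
  · exact (contDiff_const.mul contDiff_id).add (contDiff_const.mul hsm)
  · show (1 - δ) * (-γ) + a * Φ (-γ) = -c
    rw [hodd]; linarith
  · intro r _
    rw [hder]
    obtain ⟨u, v⟩ := hd01 r
    constructor <;> nlinarith
  · intro r hr _
    rw [hder, hd0 r hr]; ring
  · intro r hr
    show |r| ≤ |(1 - δ) * r + a * Φ r|
    rcases le_total 0 r with h | h
    · rw [abs_of_nonneg h]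
      exact (hpos r h hr.2).trans (le_abs_self _)
    · rw [abs_of_nonpos h]
      have := hpos (-r) (by linarith) (by linarith [hr.1])
      rw [hodd] at this
      refine le_trans ?_ (neg_le_abs _)
      linarith
end
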